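/- With notation as for a Chevalley order g_Z base-changed to a ring R where 2 and 3 are invertible: for any two roots α, β with γ := α + β ∈ Φ, one has X_α ∧ X_β ≡ (N_{αβ}/2) H_γ ∧ X_γ modulo ⋀g_R, where [X_α, X_β] = N_{αβ} X_γ. -/

import Mathlib

open ExteriorAlgebra

/-- The wedge `x ∧ y` as an element of the exterior square `⋀[R]^2 M`. -/
noncomputable def wedge2 (R : Type*) {M : Type*} [CommRing R] [AddCommGroup M] [Module R M]
    (x y : M) : ⋀[R]^2 M :=
  ⟨ExteriorAlgebra.ιMulti R 2 ![x, y],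
    ExteriorAlgebra.ιMulti_range R 2 (Set.mem_range_self _)⟩

/-- The submodule `⋀L ⊆ ⋀²L` generated by the decomposable elements `x∧y` with `⁅x,y⁆ = 0`. -/
noncomputable def wedgeDecomp (R L : Type*) [CommRing R] [LieRing L] [LieAlgebra R L] :
    Submodule R (⋀[R]^2 L) :=
  Submodule.span R {w | ∃ x y : L, ⁅x, y⁆ = 0 ∧ w = wedge2 R x y}

/-- A reduced root system in a real vector space `V`, given with a choice of coroots:
`coroot α` is the linear form `⟨·, α^∨⟩`. -/
structure RootSystemData (V : Type*) [AddCommGroup V] [Module ℝ V] where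
  /-- the set of roots -/
  Φ : Set V
  finite : Φ.Finite
  span_eq : Submodule.span ℝ Φ = ⊤
  zero_not_mem : (0 : V) ∉ Φ
  neg_mem : ∀ α ∈ Φ, -α ∈ Φ
  reduced : ∀ α ∈ Φ, ∀ c : ℝ, c • α ∈ Φ → c = 1 ∨ c = -1
  /-- the coroot `α^∨`, viewed as the linear form `⟨·, α^∨⟩` on `V` -/
  coroot : V → (V →ₗ[ℝ] ℝ)
  coroot_self : ∀ α ∈ Φ, coroot α α = 2
  reflect_mem : ∀ α ∈ Φ, ∀ β ∈ Φ, β - coroot α β • α ∈ Φ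
  integral : ∀ α ∈ Φ, ∀ β ∈ Φ, ∃ n : ℤ, coroot α β = (n : ℝ)

/-- The base change `g_R = R ⊗_ℤ g_ℤ` of a Chevalley order
`g_ℤ = h_ℤ + ∑_{α∈Φ} ℤ X_α` of a split reductive Lie algebra, together with its Chevalley
system `(X_α)`, coroots `H_α`, Cartan part `h_R` and the roots `α` viewed as `R`-linear forms
on `g_R` (restricting to the usual forms on `h_R`). -/
structure ChevalleyOrderR (R : Type*) (V : Type*) (L : Type*) [CommRing R]
    [AddCommGroup V] [Module ℝ V] [LieRing L] [LieAlgebra R L] where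
  /-- the underlying (reduced) root system -/
  rs : RootSystemData V
  /-- the Cartan part `h_R = R ⊗ h_ℤ` -/
  hR : Submodule R L
  /-- the Chevalley system `X_α` (for `α ∈ Φ`) -/
  X : V → L
  /-- the coroots `H_α` (for `α ∈ Φ`) -/
  H : V → L
  /-- the root `α` as an `R`-linear form -/
  form : V → (L →ₗ[R] R)
  /-- the structure constants `N_{αβ}` -/
  N : V → V → R
  H_mem : ∀ α ∈ rs.Φ, H α ∈ hR
  H_neg : ∀ α ∈ rs.Φ, H (-α) = -H α
  form_H_self : ∀ α ∈ rs.Φ, form α (H α) = 2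
  form_H_int : ∀ α ∈ rs.Φ, ∀ β ∈ rs.Φ, ∃ n : ℤ,
    form α (H β) = (n : R) ∧ (n : ℝ) = rs.coroot β α
  lie_hh : ∀ h ∈ hR, ∀ h' ∈ hR, ⁅h, h'⁆ = 0
  lie_hX : ∀ α ∈ rs.Φ, ∀ h ∈ hR, ⁅h, X α⁆ = form α h • X α
  lie_XnegX : ∀ α ∈ rs.Φ, ⁅X α, X (-α)⁆ = -H α
  lie_XX : ∀ α ∈ rs.Φ, ∀ β ∈ rs.Φ, α + β ∈ rs.Φ → ⁅X α, X β⁆ = N α β • X (α + β)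
  lie_XX_zero : ∀ α ∈ rs.Φ, ∀ β ∈ rs.Φ, α + β ∉ rs.Φ → α + β ≠ 0 → ⁅X α, X β⁆ = 0
  N_unit : ∀ α ∈ rs.Φ, ∀ β ∈ rs.Φ, α + β ∈ rs.Φ → IsUnit (N α β)
  N_neg : ∀ α ∈ rs.Φ, ∀ β ∈ rs.Φ, α + β ∈ rs.Φ → N (-α) (-β) = N α β
  X_indep : LinearIndependent R (fun a : rs.Φ => X a)
  sup_eq : hR ⊔ Submodule.span R (X '' rs.Φ) = ⊤
  inf_eq : hR ⊓ Submodule.span R (X '' rs.Φ) = ⊥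

open Module in
/-- Any two roots have integral Cartan numbers of absolute value at most `3`, and their product
is at most `3` unless the roots are equal or opposite. -/
theorem RootSystemData.exists_cartanNumbers {V : Type*} [AddCommGroup V] [Module ℝ V]
    (S : RootSystemData V) {α β : V} (hα : α ∈ S.Φ) (hβ : β ∈ S.Φ) :
    ∃ m n : ℤ, S.coroot β α = m ∧ S.coroot α β = n ∧ -3 ≤ m ∧ m ≤ 3 ∧
      (α ≠ β → α ≠ -β → 0 ≤ m * n ∧ m * n ≤ 3) := by
  have : Finite S.Φ := S.finite
  have : Module.Finite ℝ V := ⟨⟨S.finite.toFinset, by simpa using S.span_eq⟩⟩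
  have : IsAddTorsionFree V := .of_isTorsionFree ℝ V
  have hmaps (i : S.Φ) : Set.MapsTo (preReflection (i : V) (S.coroot i)) S.Φ S.Φ := fun x hx ↦ by
    simpa [preReflection_apply] using S.reflect_mem i i.2 x hx
  let root : S.Φ ↪ V := Function.Embedding.subtype _
  have hrange : Set.range root = S.Φ := Subtype.range_coe
  let coroot : S.Φ ↪ Dual ℝ V := ⟨fun i ↦ S.coroot i, fun i j hij ↦ by
    have hij' : S.coroot i = S.coroot j := hij
    exact Subtype.ext <| eq_of_mapsTo_reflection_of_mem S.finite
      (S.coroot_self i i.2) (S.coroot_self j j.2)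
      (hij' ▸ S.coroot_self i i.2) (hij' ▸ S.coroot_self j j.2) (hmaps i) (hmaps j) j.2⟩
  let P : RootPairing S.Φ ℝ V (Dual ℝ V) := RootPairing.mk'' (Dual.eval ℝ V) root coroot
    (fun i ↦ S.coroot_self i i.2) (fun i ↦ by rw [hrange]; exact hmaps i)
    (by rw [hrange]; exact S.span_eq)
  have : P.IsCrystallographic := ⟨fun i j ↦ by
    obtain ⟨n, hn⟩ := S.integral j j.2 i i.2
    exact ⟨n, hn.symm⟩⟩
  have : P.IsReduced := ⟨fun i j hdep ↦ by
    have hi : P.root i ≠ 0 := P.ne_zero i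
    obtain ⟨c, hc⟩ : ∃ c : ℝ, c • P.root i = P.root j := by
      by_contra! h
      exact hdep ((LinearIndependent.pair_iff' hi).2 h)
    rcases S.reduced i i.2 c (by change c • P.root i ∈ _; rw [hc]; exact j.2) with rfl | rfl
    · exact .inl (by simpa using hc)
    · exact .inr (by simp [← hc])⟩
  let i : S.Φ := ⟨α, hα⟩
  let j : S.Φ := ⟨β, hβ⟩
  refine ⟨P.pairingIn ℤ i j, P.pairingIn ℤ j i, ?_, ?_, ?_⟩
  · exact (P.algebraMap_pairingIn ℤ i j).symm
  · exact (P.algebraMap_pairingIn ℤ j i).symm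
  · have h := P.pairingIn_pairingIn_mem_set_of_isCrystal_of_isRed i j
    have h' := P.pairingIn_pairingIn_mem_set_of_isCrystal_of_isRed' i j
    simp only [Set.mem_insert_iff, Set.mem_singleton_iff, Prod.mk.injEq] at h h'
    refine ⟨by omega, by omega, fun h₁ h₂ ↦ ?_⟩
    rcases h' h₁ h₂ with h | h | h | h | h | h | h | h | h | h | h <;>
      rw [h.1, h.2] <;> norm_num

/-- `β + 4α` is never a root. -/
theorem RootSystemData.add_four_nsmul_notMem {V : Type*} [AddCommGroup V] [Module ℝ V]
    (S : RootSystemData V) {α β : V} (hα : α ∈ S.Φ) (hβ : β ∈ S.Φ) :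
    α + (α + (α + (α + β))) ∉ S.Φ := fun h ↦ by
  obtain ⟨m, -, hm, -, hm₁, -⟩ := S.exists_cartanNumbers hβ hα
  obtain ⟨k, -, hk, -, -, hk₂, -⟩ := S.exists_cartanNumbers h hα
  simp only [map_add, S.coroot_self α hα, hm] at hk
  have : 8 + m = k := by
    have : (8 + m : ℝ) = k := by linarith
    exact_mod_cast this
  omega

section Wedge

variable (R : Type*) {M : Type*} [CommRing R] [AddCommGroup M] [Module R M]

theorem wedge2_eq_ιMulti (x y : M) : wedge2 R x y = exteriorPower.ιMulti R 2 ![x, y] := rfl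

theorem update_zero_pair {M : Type*} (x y z : M) : Function.update ![x, y] 0 z = ![z, y] := by
  ext i; fin_cases i <;> rfl

theorem update_one_pair {M : Type*} (x y z : M) : Function.update ![x, y] 1 z = ![x, z] := by
  ext i; fin_cases i <;> rfl

theorem wedge2_add_left (x x' y : M) :
    wedge2 R (x + x') y = wedge2 R x y + wedge2 R x' y := by
  simpa only [wedge2_eq_ιMulti, update_zero_pair, update_one_pair] using
    (exteriorPower.ιMulti R 2).map_update_add ![0, y] 0 x x'

theorem wedge2_smul_left (c : R) (x y : M) : wedge2 R (c • x) y = c • wedge2 R x y := by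
  simpa only [wedge2_eq_ιMulti, update_zero_pair, update_one_pair] using
    (exteriorPower.ιMulti R 2).map_update_smul ![0, y] 0 c x

theorem wedge2_add_right (x y y' : M) :
    wedge2 R x (y + y') = wedge2 R x y + wedge2 R x y' := by
  simpa only [wedge2_eq_ιMulti, update_zero_pair, update_one_pair] using
    (exteriorPower.ιMulti R 2).map_update_add ![x, 0] 1 y y'

theorem wedge2_smul_right (c : R) (x y : M) : wedge2 R x (c • y) = c • wedge2 R x y := by
  simpa only [wedge2_eq_ιMulti, update_zero_pair, update_one_pair] using
    (exteriorPower.ιMulti R 2).map_update_smul ![x, 0] 1 c y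

end Wedge

theorem wedge2_mem_wedgeDecomp {R L : Type*} [CommRing R] [LieRing L] [LieAlgebra R L] {x y : L}
    (h : ⁅x, y⁆ = 0) : wedge2 R x y ∈ wedgeDecomp R L :=
  Submodule.subset_span ⟨x, y, h, rfl⟩

/-- The linear term in `t` of `exp(t ad x) h ∧ exp(t ad x) y`, for commuting `h` and `y`. -/
theorem smul_wedge2_sub_mem_wedgeDecomp {R L : Type*} [CommRing R] [LieRing L] [LieAlgebra R L]
    (h2 : IsUnit (2 : R)) (h3 : IsUnit (3 : R)) {h x y : L} {a : R}
    (hx : ⁅h, x⁆ = a • x) (hy : ⁅h, y⁆ = 0) (hxy : ⁅x, ⁅x, ⁅x, ⁅x, y⁆⁆⁆⁆ = 0) :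
    a • wedge2 R x y - wedge2 R h ⁅x, y⁆ ∈ wedgeDecomp R L := by
  have hy₁ : ⁅h, ⁅x, y⁆⁆ = a • ⁅x, y⁆ := by rw [leibniz_lie, hx, hy]; simp
  have hy₂ : ⁅h, ⁅x, ⁅x, y⁆⁆⁆ = (2 * a) • ⁅x, ⁅x, y⁆⁆ := by
    rw [leibniz_lie, hx, hy₁, smul_lie, lie_smul]; module
  have hy₃ : ⁅h, ⁅x, ⁅x, ⁅x, y⁆⁆⁆⁆ = (3 * a) • ⁅x, ⁅x, ⁅x, y⁆⁆⁆ := by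
    rw [leibniz_lie, hx, hy₂, smul_lie, lie_smul]; module
  generalize hz₁ : ⁅x, y⁆ = y₁ at *
  generalize hz₂ : ⁅x, y₁⁆ = y₂ at *
  generalize hz₃ : ⁅x, y₂⁆ = y₃ at *
  have hexp (t : R) : wedge2 R (h + (-(t * a)) • x)
      ((6 : R) • y + (6 * t) • y₁ + (3 * t ^ 2) • y₂ + (t ^ 3) • y₃) ∈ wedgeDecomp R L := by
    apply wedge2_mem_wedgeDecomp
    simp only [add_lie, lie_add, smul_lie, lie_smul, hy, hy₁, hy₂, hy₃, hz₁, hz₂, hz₃, hxy]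
    module
  have hlin := sub_mem ((wedgeDecomp R L).smul_mem 8 (sub_mem (hexp 1) (hexp (-1))))
    (sub_mem (hexp 2) (hexp (-2)))
  have h72 : IsUnit (-(2 ^ 3 * 3 ^ 2) : R) := ((h2.pow 3).mul (h3.pow 2)).neg
  rw [← Submodule.smul_mem_iff_of_isUnit _ h72]
  convert hlin using 1
  simp only [wedge2_add_left, wedge2_add_right, wedge2_smul_left, wedge2_smul_right]
  module

theorem isUnit_intCast_of_mem_Icc {R : Type*} [CommRing R] (h2 : IsUnit (2 : R))
    (h3 : IsUnit (3 : R)) {k : ℤ} (hk₁ : 1 ≤ k) (hk₄ : k ≤ 4) : IsUnit (k : R) := by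
  have h4 : IsUnit (4 : R) := by
    convert h2.mul h2 using 1
    norm_num
  interval_cases k <;> simp [h2, h3, h4]

namespace ChevalleyOrderR

variable {R V L : Type*} [CommRing R] [AddCommGroup V] [Module ℝ V] [LieRing L] [LieAlgebra R L]

/-- Bracketing with `X α` preserves the property of being a multiple of a root vector, with
the multiple being zero if the corresponding weight is not a root. -/
theorem exists_lie_X_eq_smul (C : ChevalleyOrderR R V L) {α δ : V} (hα : α ∈ C.rs.Φ)
    (hne : α + δ ≠ 0) {z : L} (hz : ∃ c : R, z = c • C.X δ ∧ (δ ∉ C.rs.Φ → c = 0)) :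
    ∃ c : R, ⁅C.X α, z⁆ = c • C.X (α + δ) ∧ (α + δ ∉ C.rs.Φ → c = 0) := by
  obtain ⟨c, rfl, hc⟩ := hz
  by_cases hδ : δ ∈ C.rs.Φ
  · by_cases hαδ : α + δ ∈ C.rs.Φ
    · exact ⟨c * C.N α δ, by rw [lie_smul, C.lie_XX α hα δ hδ hαδ, mul_smul], fun h ↦ (h hαδ).elim⟩
    · exact ⟨0, by simp [C.lie_XX_zero α hα δ hδ hαδ hne], fun _ ↦ rfl⟩
  · exact ⟨0, by simp [hc hδ], fun _ ↦ rfl⟩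

theorem lie_X_lie_X_lie_X_lie_X_eq_zero (C : ChevalleyOrderR R V L) {α β : V} (hα : α ∈ C.rs.Φ)
    (hβ : β ∈ C.rs.Φ) (hne : ∀ c : ℝ, β ≠ c • α) :
    ⁅C.X α, ⁅C.X α, ⁅C.X α, ⁅C.X α, C.X β⁆⁆⁆⁆ = 0 := by
  have hne' (c : ℝ) (δ : V) (h : δ = c • α + β) : δ ≠ 0 := fun h₀ ↦
    hne (-c) (by rw [neg_smul, ← add_eq_zero_iff_eq_neg', ← h, h₀])
  have h₀ : ∃ c : R, C.X β = c • C.X β ∧ (β ∉ C.rs.Φ → c = 0) :=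
    ⟨1, (one_smul _ _).symm, fun h ↦ (h hβ).elim⟩
  have h₁ := C.exists_lie_X_eq_smul hα (hne' 1 _ (by module)) h₀
  have h₂ := C.exists_lie_X_eq_smul hα (hne' 2 _ (by module)) h₁
  have h₃ := C.exists_lie_X_eq_smul hα (hne' 3 _ (by module)) h₂
  obtain ⟨c, hc, hc₀⟩ := C.exists_lie_X_eq_smul hα (hne' 4 _ (by module)) h₃
  rw [hc, hc₀ (C.rs.add_four_nsmul_notMem hα hβ), zero_smul]

end ChevalleyOrderR

/-- With notation as for a Chevalley order base-changed to a ring R where 2 and 3 are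
invertible: for any two roots α, β with γ := α + β again a root, one has
X_α ∧ X_β ≡ (N_{αβ}/2) H_γ ∧ X_γ modulo ⋀g_R, where ⁅X_α, X_β⁆ = N_{αβ} X_γ. -/
theorem stmt8 (R V L : Type*) [CommRing R] [AddCommGroup V] [Module ℝ V]
    [LieRing L] [LieAlgebra R L]
    (h2 : IsUnit (2 : R)) (h3 : IsUnit (3 : R))
    (C : ChevalleyOrderR R V L)
    (α β : V) (hα : α ∈ C.rs.Φ) (hβ : β ∈ C.rs.Φ) (hγ : α + β ∈ C.rs.Φ) :
    wedge2 R (C.X α) (C.X β) -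
        (Ring.inverse (2 : R) * C.N α β) • wedge2 R (C.H (α + β)) (C.X (α + β))
      ∈ wedgeDecomp R L := by
  have hαβ : α ≠ β := by
    rintro rfl
    rcases C.rs.reduced α hα 2 (by rwa [two_smul]) with h | h <;> norm_num at h
  have hαβ' : α ≠ -β := by
    rintro rfl
    exact C.rs.zero_not_mem (by simpa using hγ)
  have hne (c : ℝ) : β ≠ c • α := by
    rintro rfl
    rcases C.rs.reduced α hα c hβ with rfl | rfl <;> simp at hαβ hαβ'
  obtain ⟨p, hp, hp'⟩ := C.form_H_int α hα β hβ
  obtain ⟨q, hq, hq'⟩ := C.form_H_int β hβ α hα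
  obtain ⟨m, n, hm, hn, -, -, hmn⟩ := C.rs.exists_cartanNumbers hα hβ
  obtain rfl : p = m := by exact_mod_cast hp'.trans hm
  obtain rfl : q = n := by exact_mod_cast hq'.trans hn
  obtain ⟨hpq₀, hpq₃⟩ := hmn hαβ hαβ'
  have ha : IsUnit ((4 - p * q : ℤ) : R) :=
    isUnit_intCast_of_mem_Icc h2 h3 (by omega) (by omega)
  generalize hb : ((4 - p * q : ℤ) : R) = a at ha
  have hb' : a = 4 - p * q := by rw [← hb]; push_cast; ring
  -- A Cartan element on which `β` vanishes and `α` takes the unit value `a`.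
  obtain ⟨h, hh⟩ : ∃ h, h = (2 : R) • C.H α - (q : R) • C.H β := ⟨_, rfl⟩
  have hmem : h ∈ C.hR := hh ▸ sub_mem (C.hR.smul_mem _ (C.H_mem α hα))
    (C.hR.smul_mem _ (C.H_mem β hβ))
  have hhα : ⁅h, C.X α⁆ = a • C.X α := by
    rw [C.lie_hX α hα h hmem, hh, map_sub, map_smul, map_smul, C.form_H_self α hα, hp, hb']
    congr 1
    simp only [smul_eq_mul]
    ring
  have hhβ : ⁅h, C.X β⁆ = 0 := by
    rw [C.lie_hX β hβ h hmem, hh, map_sub, map_smul, map_smul, C.form_H_self β hβ, hq,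
      smul_eq_mul, smul_eq_mul, mul_comm, sub_self, zero_smul]
  have hlin := smul_wedge2_sub_mem_wedgeDecomp h2 h3 hhα hhβ
    (C.lie_X_lie_X_lie_X_lie_X_eq_zero hα hβ hne)
  have hN := C.lie_XX α hα β hβ hγ
  have hhγ : ⁅h, C.X (α + β)⁆ = a • C.X (α + β) := by
    apply (C.N_unit α hα β hβ hγ).smul_left_cancel.1
    rw [← lie_smul, ← hN, leibniz_lie, hhα, hhβ, smul_lie, lie_zero, add_zero, hN, smul_comm]
  obtain ⟨r, hr⟩ : ∃ r, r = Ring.inverse (2 : R) := ⟨_, rfl⟩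
  have hr₂ : r * 2 = 1 := hr ▸ Ring.inverse_mul_cancel 2 h2
  have hcomm : wedge2 R (h + (-(a * r)) • C.H (α + β)) (C.X (α + β)) ∈ wedgeDecomp R L := by
    apply wedge2_mem_wedgeDecomp
    rw [add_lie, smul_lie, hhγ, C.lie_hX _ hγ _ (C.H_mem _ hγ), C.form_H_self _ hγ, smul_smul,
      neg_mul, mul_assoc, hr₂, mul_one, neg_smul, add_neg_cancel]
  rw [hN, wedge2_smul_right] at hlin
  rw [wedge2_add_left, wedge2_smul_left] at hcomm
  rw [← Submodule.smul_mem_iff_of_isUnit _ ha, ← hr]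
  convert add_mem hlin ((wedgeDecomp R L).smul_mem (C.N α β) hcomm) using 1
  module
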